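/- Let p ≥ 1 and q ≥ 2 be integers with p+q even. Then the alternating linear Euler S̃-sum S̃_{p,q}^{−1,1} lies in the subalgebra of ℝ generated over ℚ by the set {π, G} ∪ {ζ(2k+1) : k ≥ 1} ∪ {β(2k) : k ≥ 2}. Moreover, for integers p ≥ 1 and q ≥ 1 with p+q even, the alternating linear Euler S̃-sum S̃_{p,q}^{−1,−1} lies in the subalgebra of ℝ generated over ℚ by the set {π, G} ∪ {β(2k) : k ≥ 2}. -/

import Mathlib

open scoped BigOperators

/-- Alternating odd harmonic number `h_n^{(p)}(σ) = ∑_{k=1}^n σ^{k-1}/(k-1/2)^p`. -/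
noncomputable def oddH (n p : ℕ) (σ : ℝ) : ℝ :=
  ∑ k ∈ Finset.range n, σ ^ k / ((k : ℝ) + 1 / 2) ^ p

/-- Linear Euler S̃-sum `S̃_{p,q}^{σ1,σ2} = ∑_{n≥1} σ2^{n-1} h_n^{(p)}(σ1)/n^q`. -/
noncomputable def SSum (p q : ℕ) (σ1 σ2 : ℝ) : ℝ :=
  ∑' n : ℕ, σ2 ^ n * oddH (n + 1) p σ1 / ((n : ℝ) + 1) ^ q

/-- The Riemann zeta value `ζ(s) = ∑_{n≥1} 1/n^s`. -/
noncomputable def zetaVal (s : ℕ) : ℝ := ∑' n : ℕ, 1 / ((n : ℝ) + 1) ^ s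

/-- The Dirichlet beta value `β(s) = ∑_{n≥1} (-1)^{n-1}/(2n-1)^s`. -/
noncomputable def betaVal (s : ℕ) : ℝ := ∑' n : ℕ, (-1 : ℝ) ^ n / (2 * (n : ℝ) + 1) ^ s

open Filter Topology

/-- bilateral extension of the odd harmonic numbers -/
noncomputable def Hz (τ : ℝ) (p : ℕ) : ℤ → ℝ
  | Int.ofNat n => oddH n p τ
  | Int.negSucc n => -τ * (-1) ^ p * oddH (n + 1) p τ

lemma Hz_nat (τ : ℝ) (p n : ℕ) : Hz τ p (n : ℤ) = oddH n p τ := rfl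

lemma Hz_neg (τ : ℝ) (p n : ℕ) : Hz τ p (-(n : ℤ)) = -τ * (-1) ^ p * oddH n p τ := by
  cases n with
  | zero =>
    have h : Hz τ p (-((0 : ℕ) : ℤ)) = oddH 0 p τ := rfl
    rw [h]; simp [oddH]
  | succ n => rfl

lemma oddH_succ (n p : ℕ) (τ : ℝ) : oddH (n + 1) p τ = oddH n p τ + τ ^ n / ((n : ℝ) + 1 / 2) ^ p := by
  simp [oddH, Finset.sum_range_succ]

lemma zpow_neg_tau {τ : ℝ} (hτ : τ = 1 ∨ τ = -1) (n : ℤ) : τ ^ (-n) = τ ^ n := by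
  rcases hτ with rfl | rfl
  · simp
  · rw [zpow_neg, ← inv_zpow]; norm_num

lemma tau_ne {τ : ℝ} (hτ : τ = 1 ∨ τ = -1) : τ ≠ 0 := by
  rcases hτ with rfl | rfl <;> norm_num

lemma tau_sq {τ : ℝ} (hτ : τ = 1 ∨ τ = -1) : τ * τ = 1 := by
  rcases hτ with rfl | rfl <;> norm_num

lemma tau_zsq {τ : ℝ} (hτ : τ = 1 ∨ τ = -1) (z : ℤ) : τ ^ z * τ ^ z = 1 := by
  rw [← mul_zpow, tau_sq hτ, one_zpow]

lemma Hz_step {τ : ℝ} (hτ : τ = 1 ∨ τ = -1) (p : ℕ) (z : ℤ) :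
    Hz τ p (z + 1) = Hz τ p z + τ ^ z / ((z : ℝ) + 1 / 2) ^ p := by
  rcases Int.eq_nat_or_neg z with ⟨n, rfl | rfl⟩
  · have : ((n : ℤ) + 1) = ((n + 1 : ℕ) : ℤ) := by push_cast; rfl
    rw [this, Hz_nat, Hz_nat, oddH_succ]; simp
  · cases n with
    | zero =>
      have : (-((0 : ℕ) : ℤ) + 1) = ((0 + 1 : ℕ) : ℤ) := by simp
      rw [this, Hz_nat, Hz_neg, oddH_succ]
      simp [oddH]
    | succ n =>
      have : (-((n + 1 : ℕ) : ℤ) + 1) = -((n : ℕ) : ℤ) := by push_cast; ring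
      rw [this, Hz_neg, Hz_neg, oddH_succ, zpow_neg_tau hτ]
      have h2 : (((-((n + 1 : ℕ) : ℤ) : ℤ) : ℝ) + 1 / 2) = (-1) * ((n : ℝ) + 1 / 2) := by
        push_cast; ring
      rw [h2, mul_pow, zpow_natCast, pow_succ]
      have h3 : ((-1 : ℝ) ^ p) * (-1) ^ p = 1 := by rw [← mul_pow]; simp
      have h4 : ((n : ℝ) + 1 / 2) ^ p ≠ 0 := by positivity
      have h5 : ((-1 : ℝ) ^ p) ≠ 0 := by positivity
      field_simp
      linear_combination τ ^ n * τ * h3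

/-- the shifted block sums -/
lemma sum_block {τ : ℝ} (hτ : τ = 1 ∨ τ = -1) (p : ℕ) (z : ℤ) (K : ℕ) :
    ∑ k ∈ Finset.range K, τ ^ k / ((k : ℝ) + 1 / 2 + z) ^ p
      = τ ^ z * (Hz τ p (z + K) - Hz τ p z) := by
  induction K with
  | zero => simp
  | succ K ih =>
    rw [Finset.sum_range_succ, ih]
    have := Hz_step hτ p (z + K)
    push_cast
    rw [← add_assoc, this, zpow_add₀ (tau_ne hτ)]
    push_cast
    have h := tau_zsq hτ z
    rw [show (z : ℝ) + K + 1 / 2 = K + 1 / 2 + z by ring, zpow_natCast]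
    linear_combination (-(τ ^ K / ((K : ℝ) + 1 / 2 + z) ^ p)) * h

/-- paired summand -/
noncomputable def gg (τ : ℝ) (p q : ℕ) (k n : ℕ) : ℝ :=
  τ ^ (n + 1) * (1 / (((n : ℝ) + 1) ^ q * ((k : ℝ) + 1 / 2 + (n + 1)) ^ p)
    + 1 / ((-((n : ℝ) + 1)) ^ q * ((k : ℝ) + 1 / 2 - (n + 1)) ^ p))

lemma half_ne (k : ℕ) (z : ℤ) : (k : ℝ) + 1 / 2 + z ≠ 0 := by
  intro h
  have : (2 * (k + z : ℤ) + 1 : ℝ) = 0 := by push_cast; linarith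
  have h2 : (2 * (k + z : ℤ) + 1 : ℤ) = 0 := by exact_mod_cast this
  omega

lemma half_ne' (k n : ℕ) : (k : ℝ) + 1 / 2 - (n + 1) ≠ 0 := by
  have := half_ne k (-(n + 1 : ℤ)); push_cast at this; intro h; apply this; linarith

lemma half_abs (k : ℕ) (z : ℤ) : 1 / 2 ≤ |(k : ℝ) + 1 / 2 + z| := by
  by_contra h
  push Not at h
  rw [abs_lt] at h
  have h1 : (-1 : ℝ) < ((k + z : ℤ) : ℝ) := by push_cast; linarith
  have h2 : ((k + z : ℤ) : ℝ) < 0 := by push_cast; linarith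
  have h3 : (-1 : ℤ) < k + z := by exact_mod_cast h1
  have h4 : (k + z : ℤ) < 0 := by exact_mod_cast h2
  omega

lemma gg_rec (τ : ℝ) (p q k n : ℕ) :
    gg τ (p + 1) (q + 1) k n
      = (gg τ p (q + 1) k n - gg τ (p + 1) q k n) / ((k : ℝ) + 1 / 2) := by
  unfold gg
  have h0 : (k : ℝ) + 1 / 2 ≠ 0 := by positivity
  have h1 : (n : ℝ) + 1 ≠ 0 := by positivity
  have h2 : (k : ℝ) + 1 / 2 + (n + 1) ≠ 0 := by positivity
  have h3 := half_ne' k n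
  have h4 : -((n : ℝ) + 1) ≠ 0 := neg_ne_zero.mpr h1
  generalize hX : (k : ℝ) + 1 / 2 = X at *
  generalize hY : (n : ℝ) + 1 = Y at *
  have e1 : 1 / (Y ^ (q+1) * (X + Y) ^ (p+1)) =
      (1 / (Y ^ (q+1) * (X + Y) ^ p) - 1 / (Y ^ q * (X + Y) ^ (p+1))) / X := by
    field_simp
    ring
  have e2 : 1 / ((-Y) ^ (q+1) * (X - Y) ^ (p+1)) =
      (1 / ((-Y) ^ (q+1) * (X - Y) ^ p) - 1 / ((-Y) ^ q * (X - Y) ^ (p+1))) / X := by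
    rw [pow_succ (-Y), pow_succ (X - Y)]
    generalize ha : (-Y)^q = a
    generalize hb : (X-Y)^p = b
    have : a ≠ 0 := by rw [← ha]; exact pow_ne_zero _ h4
    have : b ≠ 0 := by rw [← hb]; exact pow_ne_zero _ h3
    field_simp
    ring
  rw [e1, e2]
  ring

lemma gg_sum_q0 {τ : ℝ} (hτ : τ = 1 ∨ τ = -1) (p k N : ℕ) :
    ∑ n ∈ Finset.range N, gg τ p 0 k n
      = τ ^ k * (Hz τ p ((k : ℤ) + N + 1) - Hz τ p ((k : ℤ) - N)) - 1 / ((k : ℝ) + 1 / 2) ^ p := by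
  have hk := tau_zsq hτ k
  rw [zpow_natCast] at hk
  induction N with
  | zero =>
    have := Hz_step hτ p k
    simp only [Finset.sum_range_zero, Nat.cast_zero, add_zero, sub_zero]
    rw [this, zpow_natCast]
    push_cast
    linear_combination (-(1 / ((k : ℝ) + 1 / 2) ^ p)) * hk
  | succ N ih =>
    rw [Finset.sum_range_succ, ih]
    have s1 := Hz_step hτ p ((k : ℤ) + N + 1)
    have s2 := Hz_step hτ p ((k : ℤ) - (N + 1))
    have e : (k : ℤ) - (N + 1) + 1 = k - N := by ring
    rw [e] at s2
    push_cast
    rw [show (k : ℤ) + (N + 1) + 1 = k + N + 1 + 1 by ring, s1, s2]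
    have t1 : τ ^ ((k : ℤ) + N + 1) = τ ^ k * τ ^ (N + 1) := by
      rw [add_assoc, zpow_add₀ (tau_ne hτ)]; norm_cast
    have t2 : τ ^ ((k : ℤ) - (N + 1)) = τ ^ k * τ ^ (N + 1) := by
      rw [sub_eq_add_neg, zpow_add₀ (tau_ne hτ), zpow_neg_tau hτ]; norm_cast
    rw [t1, t2]
    unfold gg
    push_cast
    rw [show (k : ℝ) + N + 1 + 1 / 2 = k + 1 / 2 + (N + 1) by ring,
      show (k : ℝ) - (N + 1) + 1 / 2 = k + 1 / 2 - (N + 1) by ring]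
    simp only [pow_zero, one_mul]
    linear_combination (-(τ ^ (N + 1) * (1 / ((k : ℝ) + 1 / 2 + (N + 1)) ^ p
      + 1 / ((k : ℝ) + 1 / 2 - (N + 1)) ^ p))) * hk

lemma bern_rat (m : ℕ) (x : ℚ) : ∃ r : ℚ,
    (Polynomial.map (algebraMap ℚ ℝ) (Polynomial.bernoulli m)).eval (x : ℝ) = r := by
  refine ⟨(Polynomial.bernoulli m).eval x, ?_⟩
  have := Polynomial.eval_map_apply (f := algebraMap ℚ ℝ) (p := Polynomial.bernoulli m) (x := x)
  simpa using this

lemma summable_shift (s : ℕ) (hs : 2 ≤ s) : Summable (fun n : ℕ => 1 / ((n : ℝ) + 1) ^ s) := by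
  have := (summable_nat_add_iff 1).mpr (Real.summable_one_div_nat_pow.mpr (show 1 < s by omega))
  simpa using this

lemma summable_half (s : ℕ) (hs : 2 ≤ s) : Summable (fun n : ℕ => 1 / ((n : ℝ) + 1 / 2) ^ s) := by
  have h := (summable_shift s hs).mul_left ((2 : ℝ) ^ s)
  refine Summable.of_nonneg_of_le (fun n => by positivity) (fun n => ?_) h
  rw [mul_one_div, div_le_div_iff₀ (by positivity) (by positivity), one_mul, ← mul_pow]
  gcongr
  linarith [(Nat.cast_nonneg n : (0 : ℝ) ≤ n)]

lemma half_pow (k s : ℕ) : ((k : ℝ) + 1 / 2) ^ s = (2 * (k : ℝ) + 1) ^ s / 2 ^ s := by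
  rw [← div_pow]; congr 1; ring

lemma hasSum_half (s : ℕ) (hs : 2 ≤ s) :
    HasSum (fun k : ℕ => 1 / ((k : ℝ) + 1 / 2) ^ s) ((2 ^ s - 1) * zetaVal s) := by
  have hS := summable_half s hs
  have hZ := summable_shift s hs
  set f : ℕ → ℝ := fun n : ℕ => 1 / ((n : ℝ) + 1) ^ s with hf
  have fe : ∀ k : ℕ, f (2 * k) = 1 / 2 ^ s * (1 / ((k : ℝ) + 1 / 2) ^ s) := by
    intro k
    simp only [hf]
    rw [half_pow]; push_cast; field_simp
  have fo : ∀ k : ℕ, f (2 * k + 1) = 1 / 2 ^ s * f k := by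
    intro k
    simp only [hf]
    push_cast
    rw [show (2 * (k : ℝ) + 1 + 1) = 2 * (k + 1) by ring, mul_pow]; field_simp
  have h := tsum_even_add_odd (f := f) (by simp only [fe]; exact hS.mul_left _)
    (by simp only [fo]; exact hZ.mul_left _)
  simp only [fe, fo] at h
  rw [tsum_mul_left, tsum_mul_left] at h
  have hz : zetaVal s = ∑' k, f k := rfl
  rw [← hz] at h
  have : (2 ^ s - 1) * zetaVal s = ∑' k : ℕ, 1 / ((k : ℝ) + 1 / 2) ^ s := by
    have h2 : (2 : ℝ) ^ s ≠ 0 := by positivity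
    generalize (∑' k : ℕ, 1 / ((k : ℝ) + 1 / 2) ^ s) = T at h ⊢
    field_simp at h
    linarith
  rw [this]
  exact hS.hasSum

lemma hasSum_half_alt (s : ℕ) (hs : 2 ≤ s) :
    HasSum (fun k : ℕ => (-1) ^ k / ((k : ℝ) + 1 / 2) ^ s) (2 ^ s * betaVal s) := by
  have hS : Summable (fun k : ℕ => (-1 : ℝ) ^ k / ((k : ℝ) + 1 / 2) ^ s) := by
    refine Summable.of_norm_bounded (summable_half s hs) (fun k => ?_)
    rw [norm_div, norm_pow]
    simp only [norm_neg, norm_one, one_pow]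
    rw [Real.norm_of_nonneg (by positivity)]
  have : (2 ^ s * betaVal s) = ∑' k : ℕ, (-1 : ℝ) ^ k / ((k : ℝ) + 1 / 2) ^ s := by
    rw [betaVal, ← tsum_mul_left]; congr 1; funext k
    rw [half_pow]; field_simp
  rw [this]; exact hS.hasSum

lemma even_series {τ : ℝ} (hτ : τ = 1 ∨ τ = -1) (q : ℕ) (hq : 2 ≤ q) (he : Even q) :
    ∃ r : ℚ, HasSum (fun n : ℕ => τ ^ (n + 1) / ((n : ℝ) + 1) ^ q) (r * Real.pi ^ q) := by
  obtain ⟨m, hm⟩ := he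
  obtain rfl : q = 2 * m := by omega
  have key : ∀ x : ℚ, (x : ℝ) ∈ Set.Icc (0 : ℝ) 1 →
      (∀ n : ℕ, Real.cos (2 * Real.pi * n * x) = τ ^ n) →
      ∃ r : ℚ, HasSum (fun n : ℕ => τ ^ (n + 1) / ((n : ℝ) + 1) ^ (2 * m)) (r * Real.pi ^ (2 * m)) := by
    intro x hx hc
    have h := hasSum_one_div_nat_pow_mul_cos (k := m) (by omega) hx
    obtain ⟨b, hb⟩ := bern_rat (2 * m) x
    rw [hb] at h
    refine ⟨(-1) ^ (m + 1) * 2 ^ (2 * m) / 2 / (2 * m).factorial * b, ?_⟩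
    rw [← hasSum_nat_add_iff' 1] at h
    convert! h using 1
    · funext n
      rw [hc]; push_cast; ring
    · have : 2 * m ≠ 0 := by omega
      simp [this]
      rw [mul_pow]; ring
  rcases hτ with rfl | rfl
  · exact key 0 (by simp) (by simp)
  · refine key (1 / 2) (by norm_num) (fun n => ?_)
    push_cast
    rw [show 2 * Real.pi * n * (1 / 2) = n * Real.pi by ring, Real.cos_nat_mul_pi]

lemma zeta_even (q : ℕ) (hq : 2 ≤ q) (he : Even q) : ∃ r : ℚ, zetaVal q = r * Real.pi ^ q := by
  obtain ⟨r, hr⟩ := even_series (Or.inl rfl) q hq he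
  refine ⟨r, ?_⟩
  rw [← hr.tsum_eq, zetaVal]; simp

lemma beta_odd (q : ℕ) (hq : 2 ≤ q) (he : Odd q) : ∃ r : ℚ, betaVal q = r * Real.pi ^ q := by
  obtain ⟨m, rfl⟩ := he
  have h := hasSum_one_div_nat_pow_mul_sin (k := m) (by omega) (x := ((1 / 4 : ℚ) : ℝ)) (by norm_num)
  obtain ⟨b, hb⟩ := bern_rat (2 * m + 1) (1 / 4)
  rw [hb] at h
  refine ⟨(-1) ^ (m + 1) * 2 ^ (2 * m + 1) / 2 / (2 * m + 1).factorial * b, ?_⟩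
  have hinj : Function.Injective (fun n : ℕ => 2 * n + 1) := fun a b h => by simpa using h
  rw [← hinj.hasSum_iff] at h
  · rw [betaVal]
    have e : (fun n : ℕ => (-1 : ℝ) ^ n / (2 * (n : ℝ) + 1) ^ (2 * m + 1)) =
      ((fun n : ℕ => 1 / (n : ℝ) ^ (2 * m + 1) * Real.sin (2 * Real.pi * n * ((1 / 4 : ℚ) : ℝ)))
        ∘ fun n : ℕ => 2 * n + 1) := by
      funext n
      simp only [Function.comp]
      push_cast
      rw [show 2 * Real.pi * (2 * n + 1) * (1 / 4) = Real.pi / 2 + n * Real.pi by ring,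
        Real.sin_add_nat_mul_pi]
      simp; ring
    rw [e, h.tsum_eq]
    push_cast
    rw [mul_pow]; ring
  · intro n hn
    rcases Nat.even_or_odd n with ⟨l, rfl⟩ | ⟨l, rfl⟩
    · push_cast
      rw [show 2 * Real.pi * (l + l) * (1 / 4) = l * Real.pi by ring, Real.sin_nat_mul_pi, mul_zero]
    · exact absurd ⟨l, rfl⟩ hn

lemma oddH_lim {τ : ℝ} (hτ : τ = 1 ∨ τ = -1) (p : ℕ) (hp : 1 ≤ p) (h : τ * (-1) ^ p = 1) :
    ∃ r : ℚ, Tendsto (fun n => oddH n p τ) atTop (𝓝 (r * Real.pi ^ p)) := by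
  rcases hτ with rfl | rfl
  · have he : Even p := by
      by_contra ho
      rw [Nat.not_even_iff_odd] at ho
      rw [ho.neg_one_pow] at h; norm_num at h
    have hp2 : 2 ≤ p := by rcases he with ⟨m, rfl⟩; omega
    obtain ⟨r, hr⟩ := zeta_even p hp2 he
    refine ⟨(2 ^ p - 1) * r, ?_⟩
    have := (hasSum_half p hp2).tendsto_sum_nat
    rw [hr] at this
    push_cast
    rw [mul_assoc]
    simpa [oddH] using this
  · have ho : Odd p := by
      by_contra he
      rw [Nat.not_odd_iff_even] at he
      rw [he.neg_one_pow] at h; norm_num at h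
    by_cases hp1 : p = 1
    · subst hp1
      refine ⟨1 / 2, ?_⟩
      have := Real.tendsto_sum_pi_div_four.const_mul 2
      rw [show ((1 / 2 : ℚ) : ℝ) * Real.pi ^ 1 = 2 * (Real.pi / 4) by push_cast; ring]
      refine this.congr (fun n => ?_)
      rw [oddH, Finset.mul_sum]
      refine Finset.sum_congr rfl (fun k _ => ?_)
      rw [half_pow]; field_simp
    · obtain ⟨r, hr⟩ := beta_odd p (by omega) ho
      refine ⟨2 ^ p * r, ?_⟩
      have := (hasSum_half_alt p (by omega)).tendsto_sum_nat
      rw [hr] at this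
      push_cast
      rw [mul_assoc]
      exact this

lemma term_zero {τ : ℝ} (hτ : τ = 1 ∨ τ = -1) (p : ℕ) (hp : 1 ≤ p) :
    Tendsto (fun n : ℕ => τ ^ n / ((n : ℝ) + 1 / 2) ^ p) atTop (𝓝 0) := by
  have h1 : Tendsto (fun n : ℕ => (((n : ℝ) + 1 / 2) ^ p)⁻¹) atTop (𝓝 0) := by
    refine Tendsto.inv_tendsto_atTop ?_
    refine (tendsto_pow_atTop (by omega)).comp ?_
    exact tendsto_atTop_add_const_right _ _ tendsto_natCast_atTop_atTop
  refine squeeze_zero_norm (fun n => ?_) h1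
  rw [norm_div, norm_pow, Real.norm_of_nonneg (show (0:ℝ) ≤ ((n : ℝ) + 1 / 2) ^ p by positivity)]
  have : ‖τ‖ = 1 := by rcases hτ with rfl | rfl <;> simp
  rw [this, one_pow, one_div]

lemma oddH_diff {τ : ℝ} (hτ : τ = 1 ∨ τ = -1) (p : ℕ) (hp : 1 ≤ p) (m : ℕ) :
    Tendsto (fun n : ℕ => oddH (n + m) p τ - oddH n p τ) atTop (𝓝 0) := by
  induction m with
  | zero => simp
  | succ m ih =>
    have h := ih.add ((tendsto_add_atTop_iff_nat m).mpr (term_zero hτ p hp))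
    rw [add_zero] at h
    refine h.congr (fun n => ?_)
    rw [← add_assoc, oddH_succ]; push_cast; ring

/-- generators of the function space in which the inner sums live -/
def genV (τ : ℝ) (p q : ℕ) : Set (ℕ → ℝ) :=
  {f | ∃ i s : ℕ, i + s = p + q ∧ p ≤ s ∧ Even i ∧
      f = fun k : ℕ => Real.pi ^ i / ((k : ℝ) + 1 / 2) ^ s} ∪
  {f | ∃ j s : ℕ, j + s = p + q ∧ q ≤ s ∧ τ * (-1) ^ j = 1 ∧
      f = fun k : ℕ => τ ^ k * Real.pi ^ j / ((k : ℝ) + 1 / 2) ^ s}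

/-- the function space -/
noncomputable def spV (τ : ℝ) (p q : ℕ) : Submodule ℚ (ℕ → ℝ) := Submodule.span ℚ (genV τ p q)

lemma spV_div {τ : ℝ} {p q p' q' : ℕ} (hp : p' ≤ p + 1) (hq : q' ≤ q + 1)
    (hpq : p' + q' = p + q + 1) {f : ℕ → ℝ} (hf : f ∈ spV τ p q) :
    (fun k : ℕ => f k / ((k : ℝ) + 1 / 2)) ∈ spV τ p' q' := by
  unfold spV at hf
  induction hf using Submodule.span_induction with
  | mem f hf =>
    apply Submodule.subset_span
    rcases hf with ⟨i, s, h1, h2, h3, rfl⟩ | ⟨i, s, h1, h2, h3, rfl⟩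
    · refine Or.inl ⟨i, s + 1, by omega, by omega, h3, ?_⟩
      funext k; rw [pow_succ]; field_simp
    · refine Or.inr ⟨i, s + 1, by omega, by omega, h3, ?_⟩
      funext k; rw [pow_succ]; field_simp
  | zero =>
    have h0 := Submodule.zero_mem (spV τ p' q')
    convert! h0 using 1
    funext k; simp
  | add f g _ _ h1 h2 =>
    have := Submodule.add_mem _ h1 h2
    convert! this using 1
    funext k; simp [add_div]
  | smul a f _ h =>
    have := Submodule.smul_mem _ a h
    convert! this using 1
    funext k; simp [Rat.smul_def, mul_div_assoc]

lemma inner_q0 {τ : ℝ} (hτ : τ = 1 ∨ τ = -1) (p : ℕ) (hp : 1 ≤ p) :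
    ∃ f ∈ spV τ p 0, ∀ k : ℕ,
      Tendsto (fun N => ∑ n ∈ Finset.range N, gg τ p 0 k n) atTop (𝓝 (f k)) := by
  have hmem : (fun k : ℕ => 1 / ((k : ℝ) + 1 / 2) ^ p) ∈ spV τ p 0 :=
    Submodule.subset_span (Or.inl ⟨0, p, by omega, le_rfl, by simp, by simp⟩)
  have hev : ∀ k : ℕ, ∀ M : ℕ, ∑ n ∈ Finset.range (M + k), gg τ p 0 k n =
      τ ^ k * (oddH (M + (2 * k + 1)) p τ + τ * (-1) ^ p * oddH M p τ)
        - 1 / ((k : ℝ) + 1 / 2) ^ p := by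
    intro k M
    rw [gg_sum_q0 hτ]
    rw [show (k : ℤ) + ((M + k : ℕ) : ℤ) + 1 = ((M + (2 * k + 1) : ℕ) : ℤ) by push_cast; ring,
      show (k : ℤ) - ((M + k : ℕ) : ℤ) = -(M : ℤ) by push_cast; ring, Hz_nat, Hz_neg]
    ring
  have hcase : τ * (-1) ^ p = 1 ∨ τ * (-1) ^ p = -1 := by
    rcases hτ with rfl | rfl <;> rcases neg_one_pow_eq_or ℝ p with h | h <;> rw [h] <;> norm_num
  rcases hcase with h | h
  · obtain ⟨r, hr⟩ := oddH_lim hτ p hp h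
    refine ⟨(2 * r) • (fun k : ℕ => τ ^ k * Real.pi ^ p / ((k : ℝ) + 1 / 2) ^ 0)
      - (fun k : ℕ => 1 / ((k : ℝ) + 1 / 2) ^ p), ?_, ?_⟩
    · refine Submodule.sub_mem _ (Submodule.smul_mem _ _ ?_) hmem
      exact Submodule.subset_span (Or.inr ⟨p, 0, by omega, le_rfl, h, rfl⟩)
    · intro k
      rw [← tendsto_add_atTop_iff_nat k]
      simp only [hev, h, one_mul]
      have h1 := (tendsto_add_atTop_iff_nat (2 * k + 1)).mpr hr
      have h2 := ((h1.add hr).const_mul (τ ^ k)).sub_const (1 / ((k : ℝ) + 1 / 2) ^ p)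
      convert! h2 using 2
      simp [Rat.smul_def]
      ring
  · refine ⟨-(fun k : ℕ => 1 / ((k : ℝ) + 1 / 2) ^ p), Submodule.neg_mem _ hmem, ?_⟩
    intro k
    rw [← tendsto_add_atTop_iff_nat k]
    simp only [hev, h]
    have h1 := oddH_diff hτ p hp (2 * k + 1)
    have h2 := (h1.const_mul (τ ^ k)).sub_const (1 / ((k : ℝ) + 1 / 2) ^ p)
    convert! h2 using 2
    · ring
    · simp

lemma inner_p0 {τ : ℝ} (hτ : τ = 1 ∨ τ = -1) (q : ℕ) (hq : 1 ≤ q) :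
    ∃ f ∈ spV τ 0 q, ∀ k : ℕ,
      Tendsto (fun N => ∑ n ∈ Finset.range N, gg τ 0 q k n) atTop (𝓝 (f k)) := by
  rcases Nat.even_or_odd q with he | ho
  · obtain ⟨r, hr⟩ := even_series hτ q (by rcases he with ⟨m, rfl⟩; omega) he
    refine ⟨(2 * r) • (fun k : ℕ => Real.pi ^ q / ((k : ℝ) + 1 / 2) ^ 0),
      Submodule.smul_mem _ _ (Submodule.subset_span (Or.inl ⟨q, 0, by omega, le_rfl, he, rfl⟩)), ?_⟩
    intro k
    have h := (hr.mul_left 2).tendsto_sum_nat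
    convert! h using 2
    · refine Finset.sum_congr rfl (fun n _ => ?_)
      simp only [gg, he.neg_pow]
      ring
    · simp [Rat.smul_def]; ring
  · refine ⟨0, Submodule.zero_mem _, fun k => ?_⟩
    have : ∀ n, gg τ 0 q k n = 0 := by
      intro n
      simp only [gg, ho.neg_pow]
      simp
    simp [this]

lemma inner_all {τ : ℝ} (hτ : τ = 1 ∨ τ = -1) (p : ℕ) : ∀ q : ℕ, 1 ≤ p + q →
    ∃ f ∈ spV τ p q, ∀ k : ℕ,
      Tendsto (fun N => ∑ n ∈ Finset.range N, gg τ p q k n) atTop (𝓝 (f k)) := by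
  induction p with
  | zero => intro q hq; exact inner_p0 hτ q (by omega)
  | succ p ihp =>
    intro q
    induction q with
    | zero => intro _; exact inner_q0 hτ (p + 1) (by omega)
    | succ q ihq =>
      intro _
      obtain ⟨f, hf, hf'⟩ := ihp (q + 1) (by omega)
      obtain ⟨g, hg, hg'⟩ := ihq (by omega)
      refine ⟨_, Submodule.sub_mem _
        (spV_div (p' := p + 1) (q' := q + 1) le_rfl (by omega) (by omega) hf)
        (spV_div (p' := p + 1) (q' := q + 1) (by omega) le_rfl (by omega) hg), ?_⟩
      intro k
      have h := ((hf' k).sub (hg' k)).div_const ((k : ℝ) + 1 / 2)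
      convert! h using 2
      · rw [← Finset.sum_sub_distrib, Finset.sum_div]
        exact Finset.sum_congr rfl (fun n _ => gg_rec τ p q k n)
      · simp [sub_div]

lemma outer_lim {τ : ℝ} (hτ : τ = 1 ∨ τ = -1) (p q : ℕ) (hp : 1 ≤ p) (hq : 2 ≤ q)
    (hpq : Even (p + q)) (A : Subalgebra ℚ ℝ) (hpi : Real.pi ∈ A)
    (hb : ∀ s : ℕ, 2 ≤ s → Even s → betaVal s ∈ A)
    (hz : τ = -1 → ∀ s : ℕ, 3 ≤ s → Odd s → zetaVal s ∈ A)
    {f : ℕ → ℝ} (hf : f ∈ spV τ p q) :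
    ∃ l ∈ A, Tendsto (fun K => ∑ k ∈ Finset.range K, (-1) ^ k * f k) atTop (𝓝 l) := by
  have h2A : ∀ s : ℕ, (2 : ℝ) ^ s ∈ A := fun s => pow_mem (ofNat_mem A 2) s
  have hbeta : ∀ i s : ℕ, 2 ≤ s → Even s → ∃ l ∈ A, Tendsto (fun K => ∑ k ∈ Finset.range K,
      (-1) ^ k * (Real.pi ^ i / ((k : ℝ) + 1 / 2) ^ s)) atTop (𝓝 l) := by
    intro i s hs he
    refine ⟨Real.pi ^ i * (2 ^ s * betaVal s),
      mul_mem (pow_mem hpi i) (mul_mem (h2A s) (hb s hs he)), ?_⟩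
    have := ((hasSum_half_alt s hs).mul_left (Real.pi ^ i)).tendsto_sum_nat
    refine this.congr (fun K => Finset.sum_congr rfl (fun k _ => by ring))
  unfold spV at hf
  induction hf using Submodule.span_induction with
  | mem f hf =>
    rcases hf with ⟨i, s, h1, h2, h3, rfl⟩ | ⟨i, s, h1, h2, h3, rfl⟩
    · have he : Even s := by
        rw [← h1] at hpq; exact (Nat.even_add.mp hpq).mp h3
      exact hbeta i s (by rcases he with ⟨m, rfl⟩; omega) he
    · rcases hτ with rfl | rfl
      · have hi : Even i := by
          by_contra ho
          rw [Nat.not_even_iff_odd] at ho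
          rw [ho.neg_one_pow] at h3; norm_num at h3
        have he : Even s := by
          rw [← h1] at hpq; exact (Nat.even_add.mp hpq).mp hi
        simpa using hbeta i s (by omega) he
      · have hi : ¬ Even i := by
          intro he
          rw [he.neg_one_pow] at h3; norm_num at h3
        have ho : Odd s := by
          rw [← h1, Nat.even_add] at hpq
          rw [← Nat.not_even_iff_odd]; tauto
        have hs : 3 ≤ s := by rcases ho with ⟨m, rfl⟩; omega
        refine ⟨Real.pi ^ i * ((2 ^ s - 1) * zetaVal s),
          mul_mem (pow_mem hpi i) (mul_mem (sub_mem (h2A s) (one_mem A)) (hz rfl s hs ho)), ?_⟩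
        have := ((hasSum_half s (by omega)).mul_left (Real.pi ^ i)).tendsto_sum_nat
        refine this.congr (fun K => Finset.sum_congr rfl (fun k _ => ?_))
        have h : ((-1 : ℝ) ^ k) * (-1) ^ k = 1 := by rw [← mul_pow]; simp
        linear_combination (-(Real.pi ^ i / ((k : ℝ) + 1 / 2) ^ s)) * h
  | zero => exact ⟨0, zero_mem A, by simp⟩
  | add f g _ _ h1 h2 =>
    obtain ⟨a, ha, ha'⟩ := h1
    obtain ⟨b, hb, hb'⟩ := h2
    refine ⟨a + b, add_mem ha hb, (ha'.add hb').congr (fun K => ?_)⟩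
    rw [← Finset.sum_add_distrib]
    exact Finset.sum_congr rfl (fun k _ => by simp; ring)
  | smul c f _ h =>
    obtain ⟨a, ha, ha'⟩ := h
    refine ⟨c • a, A.smul_mem ha c, ?_⟩
    rw [Rat.smul_def]
    refine (ha'.const_mul (c : ℝ)).congr (fun K => ?_)
    rw [Finset.mul_sum]
    exact Finset.sum_congr rfl (fun k _ => by simp [Rat.smul_def]; ring)

lemma oddH_conv (p : ℕ) (hp : 1 ≤ p) :
    ∃ L, Tendsto (fun n => oddH n p (-1)) atTop (𝓝 L) := by
  have hanti : Antitone (fun n : ℕ => 1 / ((n : ℝ) + 1 / 2) ^ p) := by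
    intro a b hab
    have : (a : ℝ) ≤ b := by exact_mod_cast hab
    dsimp only
    gcongr
  have h0 : Tendsto (fun n : ℕ => 1 / ((n : ℝ) + 1 / 2) ^ p) atTop (𝓝 0) := by
    simpa using term_zero (Or.inl rfl) p hp
  obtain ⟨L, hL⟩ := hanti.tendsto_alternating_series_of_tendsto_zero h0
  refine ⟨L, hL.congr (fun n => ?_)⟩
  rw [oddH]
  exact Finset.sum_congr rfl (fun k _ => by ring)

lemma Hz_bdd (p : ℕ) (hp : 1 ≤ p) : ∃ B : ℝ, 0 ≤ B ∧ ∀ z, |Hz (-1) p z| ≤ B := by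
  obtain ⟨L, hL⟩ := oddH_conv p hp
  obtain ⟨B, hB⟩ := hL.abs.bddAbove_range
  have hB' : ∀ n, |oddH n p (-1)| ≤ B := fun n => hB ⟨n, rfl⟩
  refine ⟨B, (abs_nonneg _).trans (hB' 0), fun z => ?_⟩
  rcases Int.eq_nat_or_neg z with ⟨n, rfl | rfl⟩
  · exact hB' n
  · rw [Hz_neg, abs_mul, abs_mul, abs_pow]
    simpa using hB' n

lemma Hz_lim (p : ℕ) {L : ℝ} (hL : Tendsto (fun n => oddH n p (-1)) atTop (𝓝 L)) (z : ℤ) :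
    Tendsto (fun K : ℕ => Hz (-1) p (z + K)) atTop (𝓝 L) := by
  rcases Int.eq_nat_or_neg z with ⟨n, rfl | rfl⟩
  · refine ((tendsto_add_atTop_iff_nat n).mpr hL).congr (fun K => ?_)
    rw [show (n : ℤ) + K = ((K + n : ℕ) : ℤ) by push_cast; ring, Hz_nat]
  · rw [← tendsto_add_atTop_iff_nat n]
    refine hL.congr (fun K => ?_)
    rw [show -(n : ℤ) + ((K + n : ℕ) : ℤ) = (K : ℤ) by push_cast; ring, Hz_nat]

lemma gg_split (τ : ℝ) (p q k n : ℕ) : gg τ p q k n = τ ^ (n + 1) / ((n : ℝ) + 1) ^ q *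
    (1 / ((k : ℝ) + 1 / 2 + ((n + 1 : ℕ) : ℤ)) ^ p
      + (-1) ^ q * (1 / ((k : ℝ) + 1 / 2 + (-((n + 1 : ℕ) : ℤ) : ℤ)) ^ p)) := by
  unfold gg
  have h : (-((n : ℝ) + 1)) ^ q = (-1) ^ q * ((n : ℝ) + 1) ^ q := by rw [← mul_pow]; ring
  rw [h]
  push_cast
  rw [← sub_eq_add_neg]
  have h1 : ((n : ℝ) + 1) ^ q ≠ 0 := by positivity
  have h2 : ((k : ℝ) + 1 / 2 - (n + 1)) ^ p ≠ 0 := pow_ne_zero _ (half_ne' k n)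
  have h3 : ((k : ℝ) + 1 / 2 + (n + 1)) ^ p ≠ 0 := by positivity
  generalize ((k : ℝ) + 1 / 2 - (n + 1)) ^ p = a at *
  generalize ((k : ℝ) + 1 / 2 + (n + 1)) ^ p = b at *
  generalize ((n : ℝ) + 1) ^ q = c at *
  rcases neg_one_pow_eq_or ℝ q with e | e <;> rw [e] <;> field_simp

lemma gg_summable {τ : ℝ} (hτ : τ = 1 ∨ τ = -1) (p q k : ℕ) (hq : 2 ≤ q) :
    Summable (gg τ p q k) := by
  have hn : |τ| = 1 := by rcases hτ with rfl | rfl <;> simp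
  refine Summable.of_norm_bounded ((summable_shift q hq).mul_right (2 ^ p + 2 ^ p)) (fun n => ?_)
  have hz : ∀ z : ℤ, |1 / ((k : ℝ) + 1 / 2 + z) ^ p| ≤ 2 ^ p := by
    intro z
    rw [abs_div, abs_pow, abs_one]
    have h := half_abs k z
    calc 1 / |(k : ℝ) + 1 / 2 + z| ^ p ≤ 1 / (1 / 2) ^ p := by gcongr
      _ = 2 ^ p := by simp
  rw [gg_split, Real.norm_eq_abs, abs_mul, abs_div, abs_pow, hn, one_pow,
    abs_of_pos (show (0 : ℝ) < ((n : ℝ) + 1) ^ q by positivity)]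
  gcongr
  refine (abs_add_le _ _).trans (add_le_add (hz _) ?_)
  rw [abs_mul, abs_pow, abs_neg, abs_one, one_pow, one_mul]
  exact hz _

lemma block_eq (τ : ℝ) (p q n K : ℕ) :
    ∑ k ∈ Finset.range K, (-1) ^ k * gg τ p q k n = (-τ) ^ (n + 1) / ((n : ℝ) + 1) ^ q *
      ((Hz (-1) p (((n + 1 : ℕ) : ℤ) + K) - Hz (-1) p ((n + 1 : ℕ) : ℤ))
        + (-1) ^ q * (Hz (-1) p (-((n + 1 : ℕ) : ℤ) + K) - Hz (-1) p (-((n + 1 : ℕ) : ℤ)))) := by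
  have h1 := sum_block (τ := -1) (Or.inr rfl) p ((n + 1 : ℕ) : ℤ) K
  have h2 := sum_block (τ := -1) (Or.inr rfl) p (-((n + 1 : ℕ) : ℤ)) K
  rw [zpow_neg_tau (Or.inr rfl)] at h2
  rw [zpow_natCast] at h1 h2
  have e : ∑ k ∈ Finset.range K, (-1) ^ k * gg τ p q k n = τ ^ (n + 1) / ((n : ℝ) + 1) ^ q *
      (∑ k ∈ Finset.range K, (-1) ^ k / ((k : ℝ) + 1 / 2 + ((n + 1 : ℕ) : ℤ)) ^ p
      + (-1) ^ q * ∑ k ∈ Finset.range K,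
        (-1) ^ k / ((k : ℝ) + 1 / 2 + (-((n + 1 : ℕ) : ℤ) : ℤ)) ^ p) := by
    rw [Finset.mul_sum, ← Finset.sum_add_distrib, Finset.mul_sum]
    refine Finset.sum_congr rfl (fun k _ => ?_)
    rw [gg_split]; ring
  rw [e, h1, h2, neg_pow τ]
  ring

lemma main_lim {τ : ℝ} (hτ : τ = 1 ∨ τ = -1) (p q : ℕ) (hp : 1 ≤ p) (hq : 2 ≤ q)
    (hpq : Even (p + q)) (A : Subalgebra ℚ ℝ) (hpi : Real.pi ∈ A)
    (hb : ∀ s : ℕ, 2 ≤ s → Even s → betaVal s ∈ A)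
    (hz : τ = -1 → ∀ s : ℕ, 3 ≤ s → Odd s → zetaVal s ∈ A) :
    SSum p q (-1) (-τ) ∈ A := by
  have hn : |(-τ)| = 1 := by rcases hτ with rfl | rfl <;> simp
  have hτ' : -τ = 1 ∨ -τ = -1 := by rcases hτ with rfl | rfl <;> simp
  obtain ⟨L, hL⟩ := oddH_conv p hp
  obtain ⟨B, hB0, hB⟩ := Hz_bdd p hp
  obtain ⟨f, hf, hf'⟩ := inner_all hτ p q (by omega)
  obtain ⟨l, hlA, hl⟩ := outer_lim hτ p q hp hq hpq A hpi hb hz hf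
  have hsum : ∀ k, HasSum (gg τ p q k) (f k) := by
    intro k
    have hs := (gg_summable hτ p q k hq).hasSum
    rwa [tendsto_nhds_unique hs.tendsto_sum_nat (hf' k)] at hs
  have hpar : (-1 : ℝ) ^ q * (-1) ^ p = 1 := by
    rw [← pow_add, add_comm]; exact hpq.neg_one_pow
  set g : ℕ → ℝ := fun n => (-τ) ^ (n + 1) / ((n : ℝ) + 1) ^ q *
    ((1 + (-1) ^ q) * L - 2 * oddH (n + 1) p (-1)) with hg
  have hT : Tendsto (fun K : ℕ => ∑' n, ∑ k ∈ Finset.range K, (-1) ^ k * gg τ p q k n) atTop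
      (𝓝 (∑' n, g n)) := by
    refine tendsto_tsum_of_dominated_convergence
      (bound := fun n : ℕ => 1 / ((n : ℝ) + 1) ^ q * (4 * B))
      ((summable_shift q hq).mul_right _) ?_ ?_
    · intro n
      simp only [block_eq]
      have h1 := (Hz_lim p hL ((n + 1 : ℕ) : ℤ)).sub_const (Hz (-1) p ((n + 1 : ℕ) : ℤ))
      have h2 := (Hz_lim p hL (-((n + 1 : ℕ) : ℤ))).sub_const (Hz (-1) p (-((n + 1 : ℕ) : ℤ)))
      have h3 := (h1.add (h2.const_mul ((-1) ^ q))).const_mul ((-τ) ^ (n + 1) / ((n : ℝ) + 1) ^ q)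
      convert! h3 using 2
      rw [hg, Hz_neg, Hz_nat]
      dsimp only
      congr 1
      linear_combination (oddH (n + 1) p (-1)) * hpar
    · refine Eventually.of_forall (fun K n => ?_)
      rw [block_eq, Real.norm_eq_abs, abs_mul, abs_div, abs_pow, hn, one_pow,
        abs_of_pos (show (0 : ℝ) < ((n : ℝ) + 1) ^ q by positivity)]
      gcongr
      refine (abs_add_le _ _).trans ?_
      rw [abs_mul, abs_pow, abs_neg, abs_one, one_pow, one_mul]
      have a1 := abs_sub (Hz (-1) p (((n + 1 : ℕ) : ℤ) + K)) (Hz (-1) p ((n + 1 : ℕ) : ℤ))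
      have a2 := abs_sub (Hz (-1) p (-((n + 1 : ℕ) : ℤ) + K)) (Hz (-1) p (-((n + 1 : ℕ) : ℤ)))
      linarith [hB (((n + 1 : ℕ) : ℤ) + K), hB ((n + 1 : ℕ) : ℤ),
        hB (-((n + 1 : ℕ) : ℤ) + K), hB (-((n + 1 : ℕ) : ℤ))]
  have hE : ∀ K : ℕ, ∑' n, ∑ k ∈ Finset.range K, (-1) ^ k * gg τ p q k n
      = ∑ k ∈ Finset.range K, (-1) ^ k * f k := fun K =>
    (hasSum_sum (fun k _ => (hsum k).mul_left ((-1) ^ k))).tsum_eq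
  simp only [hE] at hT
  have hgl : ∑' n, g n = l := tendsto_nhds_unique hT hl
  -- summability of the pieces
  have hZs : Summable (fun n : ℕ => (-τ) ^ (n + 1) / ((n : ℝ) + 1) ^ q) := by
    refine Summable.of_norm_bounded (summable_shift q hq) (fun n => ?_)
    rw [Real.norm_eq_abs, abs_div, abs_pow, hn, one_pow,
        abs_of_pos (show (0 : ℝ) < ((n : ℝ) + 1) ^ q by positivity)]
  have hSs : Summable (fun n : ℕ => (-τ) ^ n * oddH (n + 1) p (-1) / ((n : ℝ) + 1) ^ q) := by
    refine Summable.of_norm_bounded ((summable_shift q hq).mul_right B) (fun n => ?_)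
    rw [Real.norm_eq_abs, abs_div, abs_mul, abs_pow, hn, one_pow, one_mul,
        abs_of_pos (show (0 : ℝ) < ((n : ℝ) + 1) ^ q by positivity), one_div_mul_eq_div]
    gcongr
    exact hB ((n + 1 : ℕ) : ℤ)
  have hgs : ∑' n, g n = (1 + (-1) ^ q) * L * (∑' n : ℕ, (-τ) ^ (n + 1) / ((n : ℝ) + 1) ^ q)
      + 2 * τ * SSum p q (-1) (-τ) := by
    rw [SSum, ← tsum_mul_left, ← tsum_mul_left, ← (hZs.mul_left _).tsum_add (hSs.mul_left _)]
    congr 1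
    funext n
    rw [hg]
    dsimp only
    rw [pow_succ]
    ring
  have hLZ : (1 + (-1) ^ q) * L * (∑' n : ℕ, (-τ) ^ (n + 1) / ((n : ℝ) + 1) ^ q) ∈ A := by
    rcases Nat.even_or_odd q with he | ho
    · obtain ⟨r, hr⟩ := even_series hτ' q hq he
      have hpe : Even p := (Nat.even_add.mp hpq).mpr he
      have hp2 : 2 ≤ p := by rcases hpe with ⟨m, rfl⟩; omega
      have hL2 : L = 2 ^ p * betaVal p :=
        tendsto_nhds_unique hL (hasSum_half_alt p hp2).tendsto_sum_nat
      rw [hr.tsum_eq, hL2, he.neg_one_pow]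
      have hrA : (r : ℝ) ∈ A := by simpa using A.algebraMap_mem r
      exact mul_mem (mul_mem (add_mem (one_mem A) (one_mem A))
        (mul_mem (pow_mem (ofNat_mem A 2) p) (hb p hp2 hpe))) (mul_mem hrA (pow_mem hpi q))
    · rw [ho.neg_one_pow]; simp [zero_mem]
  have hfin : SSum p q (-1) (-τ) = (1 / 2 : ℚ) • (τ * (l - (1 + (-1) ^ q) * L *
      (∑' n : ℕ, (-τ) ^ (n + 1) / ((n : ℝ) + 1) ^ q))) := by
    rw [← hgl, hgs, Rat.smul_def]
    push_cast
    linear_combination (-SSum p q (-1) (-τ)) * tau_sq hτ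
  rw [hfin]
  have hτA : τ ∈ A := by
    rcases hτ with rfl | rfl
    · exact one_mem A
    · exact neg_mem (one_mem A)
  exact A.smul_mem (mul_mem hτA (sub_mem hlA hLZ)) _

lemma oddH_lower (p n : ℕ) (hp : 1 ≤ p) : 2 / 3 ≤ oddH (n + 1) p (-1) := by
  have key : ∀ m : ℕ, 2 / 3 ≤ oddH (2 * m + 1) p (-1) ∧ 2 / 3 ≤ oddH (2 * m + 2) p (-1) := by
    intro m
    induction m with
    | zero =>
      have h1 : (2 : ℝ) ≤ 2 ^ p := by
        calc (2 : ℝ) = 2 ^ 1 := by norm_num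
          _ ≤ 2 ^ p := pow_le_pow_right₀ (by norm_num) hp
      have h2 : (2 / 3 : ℝ) ^ p ≤ 1 := pow_le_one₀ (by norm_num) (by norm_num)
      have e1 : oddH 1 p (-1) = 2 ^ p := by simp [oddH]
      have e2 : oddH 2 p (-1) = 2 ^ p - (2 / 3) ^ p := by
        rw [oddH_succ 1, e1]
        norm_num
        rw [show (2 / 3 : ℝ) = (3 / 2)⁻¹ by norm_num, inv_pow]
        ring
      simp only [Nat.mul_zero, Nat.zero_add]
      rw [e1, e2]
      constructor <;> linarith
    | succ m ih =>
      have s1 := oddH_succ (2 * m + 2) p (-1)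
      have s2 := oddH_succ (2 * m + 3) p (-1)
      rw [show (-1 : ℝ) ^ (2 * m + 2) = 1 from Even.neg_one_pow ⟨m + 1, by ring⟩] at s1
      rw [show (-1 : ℝ) ^ (2 * m + 3) = -1 from Odd.neg_one_pow ⟨m + 1, by ring⟩] at s2
      have p1 : 0 < 1 / (((2 * m + 2 : ℕ) : ℝ) + 1 / 2) ^ p := by positivity
      have p2 : 1 / (((2 * m + 3 : ℕ) : ℝ) + 1 / 2) ^ p ≤ 1 / (((2 * m + 2 : ℕ) : ℝ) + 1 / 2) ^ p := by
        gcongr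
        omega
      rw [show 2 * (m + 1) + 1 = 2 * m + 2 + 1 by ring, show 2 * (m + 1) + 2 = 2 * m + 3 + 1 by ring]
      rw [neg_div] at s2
      rw [show 2 * m + 2 + 1 = 2 * m + 3 by ring] at *
      constructor <;> linarith [ih.2]
  rcases Nat.even_or_odd n with ⟨m, rfl⟩ | ⟨m, rfl⟩
  · rw [← two_mul]; exact (key m).1
  · exact (key m).2

lemma q_one (p : ℕ) (hp : 1 ≤ p) : SSum p 1 (-1) (-1) = 0 := by
  rw [SSum]
  refine tsum_eq_zero_of_not_summable (fun h => ?_)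
  have h1 : Summable (fun n : ℕ => (3 / 2) * |(-1) ^ n * oddH (n + 1) p (-1) / ((n : ℝ) + 1) ^ 1|) :=
    h.abs.mul_left _
  have h2 : Summable (fun n : ℕ => 1 / ((n : ℝ) + 1)) := by
    refine Summable.of_nonneg_of_le (fun n => by positivity) (fun n => ?_) h1
    have := oddH_lower p n hp
    rw [abs_div, abs_mul, abs_pow, abs_neg, abs_one, one_pow, one_mul, pow_one,
      abs_of_pos (show (0 : ℝ) < (n : ℝ) + 1 by positivity), abs_of_nonneg (by linarith),
      ← mul_div_assoc]
    gcongr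
    linarith
  have h3 : Summable (fun n : ℕ => 1 / (n : ℝ)) := by
    rw [← summable_nat_add_iff 1]; simpa using h2
  exact Real.not_summable_one_div_natCast h3

theorem stmt5 :
    (∀ p q : ℕ, 1 ≤ p → 2 ≤ q → Even (p + q) →
      SSum p q (-1) 1 ∈ Algebra.adjoin ℚ
        ({Real.pi, betaVal 2}
          ∪ {x : ℝ | ∃ k : ℕ, 1 ≤ k ∧ x = zetaVal (2 * k + 1)}
          ∪ {x : ℝ | ∃ k : ℕ, 2 ≤ k ∧ x = betaVal (2 * k)})) ∧
    (∀ p q : ℕ, 1 ≤ p → 1 ≤ q → Even (p + q) →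
      SSum p q (-1) (-1) ∈ Algebra.adjoin ℚ
        ({Real.pi, betaVal 2} ∪ {x : ℝ | ∃ k : ℕ, 2 ≤ k ∧ x = betaVal (2 * k)})) := by
  constructor
  · intro p q hp hq hpq
    have h := main_lim (τ := -1) (Or.inr rfl) p q hp hq hpq (Algebra.adjoin ℚ
        ({Real.pi, betaVal 2}
          ∪ {x : ℝ | ∃ k : ℕ, 1 ≤ k ∧ x = zetaVal (2 * k + 1)}
          ∪ {x : ℝ | ∃ k : ℕ, 2 ≤ k ∧ x = betaVal (2 * k)}))
      (Algebra.subset_adjoin (by simp)) ?_ ?_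
    · simpa using h
    · rintro s hs ⟨m, rfl⟩
      rw [← two_mul]
      by_cases hm : m = 1
      · subst hm; exact Algebra.subset_adjoin (by simp)
      · exact Algebra.subset_adjoin (Or.inr ⟨m, by omega, rfl⟩)
    · rintro - s hs ⟨m, rfl⟩
      exact Algebra.subset_adjoin (Or.inl (Or.inr ⟨m, by omega, rfl⟩))
  · intro p q hp hq hpq
    by_cases hq1 : q = 1
    · subst hq1
      rw [q_one p hp]
      exact zero_mem _
    refine main_lim (τ := 1) (Or.inl rfl) p q hp (by omega) hpq (Algebra.adjoin ℚ
        ({Real.pi, betaVal 2} ∪ {x : ℝ | ∃ k : ℕ, 2 ≤ k ∧ x = betaVal (2 * k)}))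
      (Algebra.subset_adjoin (by simp)) ?_ ?_
    · rintro s hs ⟨m, rfl⟩
      rw [← two_mul]
      by_cases hm : m = 1
      · subst hm; exact Algebra.subset_adjoin (by simp)
      · exact Algebra.subset_adjoin (Or.inr ⟨m, by omega, rfl⟩)
    · intro h; norm_num at h
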